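/- arXiv:2503.18663 — 2 statements merged into one kernel-verified Lean document; each statement's English description precedes it below -/
import Mathlib

section
/- For an integer k ≥ 4, define B : {1,…,k} → ℕ by B(k) = 2, B(k−1) = ⌈(k−1)/2⌉ + 2, B(k−2) = ⌈(k−2)/2⌉ + 2, and B(i) = B(i+2) + ⌈i/2⌉ + 1 for 1 ≤ i ≤ k−3; define Rlen(k−1) = B(k−1) − 1 and Rlen(i) = B(i) − 2 for 1 ≤ i ≤ k−2; and define N(k) = Σ_{i=1}^{k} B(i) + Σ_{i=1}^{k−1} Rlen(i). Then there exist real constants c₁ > 0 and c₂ > 0 such that for every integer k ≥ 4, c₁ · k³ ≤ N(k) ≤ c₂ · k³. -/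
/-- Segment lengths of the black spiral `P_b` in the lower-bound construction:
`B k k = 2`, `B k (k-1) = ⌈(k-1)/2⌉ + 2`, `B k (k-2) = ⌈(k-2)/2⌉ + 2`, and
`B k i = B k (i+2) + ⌈i/2⌉ + 1` for `1 ≤ i ≤ k-3`. -/
def B (k i : ℕ) : ℕ :=
  if h : k ≤ i + 2 then
    if i = k then 2
    else (i + 1) / 2 + 2
  else
    B k (i + 2) + (i + 1) / 2 + 1
termination_by k - i
decreasing_by omega

/-- Segment lengths of the red spiral `P_r`:
`Rlen k (k-1) = B k (k-1) - 1` and `Rlen k i = B k i - 2` for `1 ≤ i ≤ k-2`. -/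
def Rlen (k i : ℕ) : ℕ :=
  if i = k - 1 then B k i - 1 else B k i - 2

/-- Total number of nodes of the lower-bound construction. -/
def Nnodes (k : ℕ) : ℕ :=
  (∑ i ∈ Finset.Icc 1 k, B k i) + ∑ i ∈ Finset.Icc 1 (k - 1), Rlen k i

theorem B_lower (k i : ℕ) (hi : i ≤ k) : k ^ 2 ≤ 8 * B k i + i ^ 2 := by
  induction i using B.induct (k := k) with
  | case1 h => rw [B]; simp
  | case2 i h hne =>
    rw [B, dif_pos h, if_neg hne]
    have h2 : i ≤ 2 * ((i + 1) / 2) := by omega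
    rcases (by omega : k = i + 1 ∨ k = i + 2) with rfl | rfl <;> nlinarith
  | case3 i h ih =>
    rw [B, dif_neg h]
    have h2 : i ≤ 2 * ((i + 1) / 2) := by omega
    have := ih (by omega)
    nlinarith

theorem B_upper (k i : ℕ) (hi : i ≤ k) : B k i + i ^ 2 ≤ k ^ 2 + k + 2 := by
  induction i using B.induct (k := k) with
  | case1 h => rw [B]; simp; omega
  | case2 i h hne =>
    rw [B, dif_pos h, if_neg hne]
    have h2 : (i + 1) / 2 ≤ k := by omega
    have : i ^ 2 ≤ k ^ 2 := Nat.pow_le_pow_left hi 2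
    omega
  | case3 i h ih =>
    rw [B, dif_neg h]
    have h2 : (i + 1) / 2 ≤ i + 1 := by omega
    have := ih (by omega)
    nlinarith

theorem sum_sq_Icc (k : ℕ) : 6 * ∑ i ∈ Finset.Icc 1 k, i ^ 2 = k * (k + 1) * (2 * k + 1) := by
  induction k with
  | zero => simp
  | succ n ih =>
    rw [Finset.sum_Icc_succ_top (by omega), mul_add, ih]
    ring

theorem Nnodes_lower (k : ℕ) (hk : 4 ≤ k) : k ^ 3 ≤ 64 * Nnodes k := by
  have h : ∑ i ∈ Finset.Icc 1 k, k ^ 2 ≤ ∑ i ∈ Finset.Icc 1 k, (8 * B k i + i ^ 2) :=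
    Finset.sum_le_sum fun i hi => B_lower k i (Finset.mem_Icc.mp hi).2
  rw [Finset.sum_add_distrib, ← Finset.mul_sum] at h
  simp only [Finset.sum_const, Nat.card_Icc, smul_eq_mul, Nat.add_sub_cancel] at h
  have h2 := sum_sq_Icc k
  have h3 : ∑ i ∈ Finset.Icc 1 k, B k i ≤ Nnodes k := Nat.le_add_right _ _
  have h4 : 4 * k ^ 2 ≤ k ^ 3 := by nlinarith [Nat.mul_le_mul_right (k ^ 2) hk]
  have h5 : 4 * k ≤ k ^ 2 := by nlinarith
  nlinarith

theorem Nnodes_upper (k : ℕ) (hk : 4 ≤ k) : Nnodes k ≤ 4 * k ^ 3 := by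
  have hB : ∀ i ≤ k, B k i ≤ 2 * k ^ 2 := fun i hi => by
    have := B_upper k i hi
    nlinarith
  have h1 : ∑ i ∈ Finset.Icc 1 k, B k i ≤ k * (2 * k ^ 2) := by
    have := Finset.sum_le_card_nsmul (Finset.Icc 1 k) (B k) (2 * k ^ 2)
      fun i hi => hB i (Finset.mem_Icc.mp hi).2
    simpa using this
  have h2 : ∑ i ∈ Finset.Icc 1 (k - 1), Rlen k i ≤ (k - 1) * (2 * k ^ 2) := by
    have := Finset.sum_le_card_nsmul (Finset.Icc 1 (k - 1)) (Rlen k) (2 * k ^ 2)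
      fun i hi => by
        have := hB i (by have := (Finset.mem_Icc.mp hi).2; omega)
        unfold Rlen
        split_ifs <;> omega
    simpa using this
  have h3 : (k - 1) * (2 * k ^ 2) ≤ k * (2 * k ^ 2) := Nat.mul_le_mul_right _ (by omega)
  unfold Nnodes
  nlinarith

/-- The lower-bound construction has `n = Θ(k³)` nodes, i.e., `k = Θ(∛n)`
turning points. -/
theorem construction_size_theta_k_cubed :
    ∃ c₁ c₂ : ℝ, 0 < c₁ ∧ 0 < c₂ ∧
      ∀ k : ℕ, 4 ≤ k →
        c₁ * (k : ℝ) ^ 3 ≤ (Nnodes k : ℝ) ∧ (Nnodes k : ℝ) ≤ c₂ * (k : ℝ) ^ 3 := by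
  refine ⟨1 / 64, 4, by norm_num, by norm_num, fun k hk => ⟨?_, ?_⟩⟩
  · have h : (k : ℝ) ^ 3 ≤ 64 * (Nnodes k : ℝ) := by exact_mod_cast Nnodes_lower k hk
    linarith
  · exact_mod_cast Nnodes_upper k hk
end

section
/- For an integer k ≥ 4, define B : {1,…,k} → ℕ by B(k) = 2, B(k−1) = ⌈(k−1)/2⌉ + 2, B(k−2) = ⌈(k−2)/2⌉ + 2, and B(i) = B(i+2) + ⌈i/2⌉ + 1 for 1 ≤ i ≤ k−3; define Rlen(k−1) = B(k−1) − 1 and Rlen(i) = B(i) − 2 for 1 ≤ i ≤ k−2. Then for every i with 1 ≤ i ≤ k−1, Rlen(i) ≥ ⌊(k−2)/2⌋; in particular every red segment of the construction has length Ω(k). -/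
theorem B_lower_bound (k i : ℕ) (hi : i < k) : (k - 2) / 2 + 2 ≤ B k i := by
  rw [B]
  split_ifs with h h1
  · omega
  · omega
  · have := B_lower_bound k (i + 2) (by omega)
    omega
termination_by k - i

/-- Every red segment of the lower-bound construction has length at least
`⌊(k-2)/2⌋`, i.e., length `Ω(k)`. -/
theorem red_segment_length_omega_k (k : ℕ) (hk : 4 ≤ k) :
    ∀ i : ℕ, 1 ≤ i → i ≤ k - 1 → (k - 2) / 2 ≤ Rlen k i := by
  intro i h1 h2
  have := B_lower_bound k i (by omega)
  unfold Rlen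
  split_ifs <;> omega
end
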